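/- For every alternating bilinear form T on ℝ^n and all u, v ∈ ℝ^n, writing B = ∑_{1≤k<l≤n} T(e_k,e_l) ĉ(e_k) ĉ(e_l), one has ∫_{S^{n−1}} Tr( ∑_{i=1}^n ξ_i · ĉ(u) ĉ(v) c(e_i) B c(ξ) ) dσ(ξ) = T(u,v) · 2^n · vol(S^{n−1}). -/

import Mathlib

open MeasureTheory

noncomputable section

/-- Euclidean space `ℝ^n` with its standard inner product. -/
abbrev Eucl (n : ℕ) := EuclideanSpace ℝ (Fin n)

/-- The exterior algebra `Λℝ^n`. -/
abbrev ExtAlg (n : ℕ) := ExteriorAlgebra ℝ (Eucl n)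

/-- The standard orthonormal basis vector `e_i` of `ℝ^n`. -/
def e (n : ℕ) (i : Fin n) : Eucl n := EuclideanSpace.single i 1

/-- Left exterior multiplication `ε(x)` on `Λℝ^n`. -/
def eps {n : ℕ} (x : Eucl n) : Module.End ℝ (ExtAlg n) :=
  LinearMap.mulLeft ℝ (ExteriorAlgebra.ι ℝ x)

/-- Interior multiplication (contraction) `ι(x)` on `Λℝ^n`, determined by the inner product. -/
def iot {n : ℕ} (x : Eucl n) : Module.End ℝ (ExtAlg n) :=
  CliffordAlgebra.contractLeft (Q := (0 : QuadraticForm ℝ (Eucl n))) (innerSL ℝ x).toLinearMap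

/-- The Clifford action `c(x) = ε(x) − ι(x)`. -/
def c {n : ℕ} (x : Eucl n) : Module.End ℝ (ExtAlg n) := eps x - iot x

/-- The Clifford action `ĉ(x) = ε(x) + ι(x)`. -/
def hc {n : ℕ} (x : Eucl n) : Module.End ℝ (ExtAlg n) := eps x + iot x

/-- The trace of a linear endomorphism of `Λℝ^n`. -/
def Tr {n : ℕ} : Module.End ℝ (ExtAlg n) →ₗ[ℝ] ℝ := LinearMap.trace ℝ (ExtAlg n)

/-- The surface measure `σ` on the unit sphere `S^{n-1} ⊆ ℝ^n`. -/
def sphMeasure (n : ℕ) : Measure (Metric.sphere (0 : Eucl n) 1) :=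
  (volume : Measure (Eucl n)).toSphere

/-- The total surface measure `vol(S^{n-1})` of the unit sphere. -/
def volSph (n : ℕ) : ℝ := (sphMeasure n Set.univ).toReal

theorem eps_add {n : ℕ} (x y : Eucl n) : eps (x + y) = eps x + eps y := by
  refine LinearMap.ext fun a => ?_
  simp [eps, add_mul]

theorem eps_smul {n : ℕ} (r : ℝ) (x : Eucl n) : eps (r • x) = r • eps x := by
  refine LinearMap.ext fun a => ?_
  simp [eps]

theorem iot_add {n : ℕ} (x y : Eucl n) : iot (x + y) = iot x + iot y := by
  simp only [iot, map_add, ContinuousLinearMap.toLinearMap_add]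

theorem iot_smul {n : ℕ} (r : ℝ) (x : Eucl n) : iot (r • x) = r • iot x := by
  have h : (innerSL ℝ (r • x)).toLinearMap = r • (innerSL ℝ x).toLinearMap := by
    simp only [map_smul, ContinuousLinearMap.toLinearMap_smul]
  rw [iot, h, map_smul, iot]

theorem isLinearMap_c {n : ℕ} : IsLinearMap ℝ (c : Eucl n → Module.End ℝ (ExtAlg n)) where
  map_add x y := by simp only [c, eps_add, iot_add]; abel
  map_smul r x := by simp only [c, eps_smul, iot_smul, smul_sub]

theorem eps_mul_eps {n : ℕ} (x y : Eucl n) : eps x * eps y = -(eps y * eps x) := by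
  rw [eq_neg_iff_add_eq_zero]
  refine LinearMap.ext fun a => ?_
  have h := ExteriorAlgebra.ι_add_mul_swap (R := ℝ) x y
  simp only [eps, LinearMap.add_apply, Module.End.mul_apply, LinearMap.mulLeft_apply,
    ← mul_assoc, ← add_mul, h, zero_mul, LinearMap.zero_apply]

theorem iot_mul_iot {n : ℕ} (x y : Eucl n) : iot x * iot y = -(iot y * iot x) :=
  LinearMap.ext fun a =>
    CliffordAlgebra.contractLeft_comm (Q := (0 : QuadraticForm ℝ (Eucl n))) _ _ a

theorem iot_mul_eps {n : ℕ} (x y : Eucl n) :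
    iot x * eps y = inner ℝ x y • 1 - eps y * iot x :=
  LinearMap.ext fun a =>
    CliffordAlgebra.contractLeft_ι_mul (Q := (0 : QuadraticForm ℝ (Eucl n))) _ _ a

/-- The Clifford relation for the operators `ĉ`. -/
theorem hc_mul_hc {n : ℕ} (x y : Eucl n) :
    hc x * hc y = (2 * inner ℝ x y) • 1 - hc y * hc x := by
  have h := real_inner_comm x y
  simp only [hc, add_mul, mul_add, iot_mul_eps, eps_mul_eps x y, iot_mul_iot x y, h, two_mul,
    add_smul]
  abel

theorem c_mul_hc {n : ℕ} (x y : Eucl n) : c x * hc y = -(hc y * c x) := by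
  have h := real_inner_comm x y
  simp only [c, hc, add_mul, mul_add, sub_mul, mul_sub, iot_mul_eps, eps_mul_eps x y,
    iot_mul_iot x y, h]
  abel

theorem c_mul_self {n : ℕ} (x : Eucl n) : c x * c x = (-‖x‖ ^ 2) • 1 := by
  have h₁ : eps x * eps x = 0 := LinearMap.ext fun a => by
    simp [eps, ← mul_assoc]
  have h₂ : iot x * iot x = 0 := LinearMap.ext fun a =>
    CliffordAlgebra.contractLeft_contractLeft (Q := (0 : QuadraticForm ℝ (Eucl n))) _ a
  refine Eq.trans ?_ (neg_smul (‖x‖ ^ 2) (1 : Module.End ℝ (ExtAlg n))).symm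
  simp only [c, sub_mul, mul_sub, iot_mul_eps, h₁, h₂, real_inner_self_eq_norm_sq]
  abel

theorem commute_mul_of_mul_eq_neg_mul {A : Type*} [Ring A] {a b d : A} (hb : a * b = -(b * a))
    (hd : a * d = -(d * a)) : Commute a (b * d) := by
  rw [commute_iff_eq, ← mul_assoc, hb, neg_mul, mul_assoc, hd, mul_neg, neg_neg, mul_assoc]

theorem commute_c_hc_mul_hc {n : ℕ} (x y z : Eucl n) : Commute (c x) (hc y * hc z) :=
  commute_mul_of_mul_eq_neg_mul (c_mul_hc x y) (c_mul_hc x z)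

theorem Tr_one {n : ℕ} : Tr (1 : Module.End ℝ (ExtAlg n)) = 2 ^ n := by
  have b : Module.Basis (Finset (Fin n)) ℝ (ExtAlg n) :=
    (EuclideanSpace.basisFun (Fin n) ℝ).toBasis.ExteriorAlgebra
  have := Module.Free.of_basis b
  have := Module.Finite.of_basis b
  rw [Tr, LinearMap.trace_one, Module.finrank_eq_card_basis b]
  simp

theorem Tr_mul_comm {n : ℕ} (f g : Module.End ℝ (ExtAlg n)) : Tr (f * g) = Tr (g * f) :=
  LinearMap.trace_mul_comm ℝ f g

theorem Tr_hc_mul_hc {n : ℕ} (x y : Eucl n) : Tr (hc x * hc y) = inner ℝ x y * 2 ^ n := by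
  have h := congrArg Tr (hc_mul_hc x y)
  rw [map_sub, map_smul, Tr_one, Tr_mul_comm (hc y), smul_eq_mul] at h
  linarith

theorem Tr_hc_mul_hc_mul_hc_mul_hc {n : ℕ} (x y z w : Eucl n) :
    Tr (hc x * hc y * (hc z * hc w)) =
      (inner ℝ x y * inner ℝ z w - inner ℝ x z * inner ℝ y w + inner ℝ x w * inner ℝ y z)
        * 2 ^ n := by
  have h : hc x * hc y * (hc z * hc w) = (2 * inner ℝ x y) • (hc z * hc w)
      - (2 * inner ℝ x z) • (hc y * hc w) + (2 * inner ℝ x w) • (hc y * hc z)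
      - hc y * hc z * hc w * hc x := by
    rw [hc_mul_hc x y, sub_mul, mul_assoc (hc y), ← mul_assoc (hc x), hc_mul_hc x z, sub_mul,
      mul_assoc (hc z), hc_mul_hc x w]
    simp only [mul_sub, smul_mul_assoc, mul_smul_comm, one_mul, mul_one, mul_assoc]
    abel
  have h' := congrArg Tr h
  rw [map_sub, map_add, map_sub, map_smul, map_smul, map_smul, Tr_mul_comm _ (hc x)] at h'
  simp only [Tr_hc_mul_hc, smul_eq_mul, ← mul_assoc] at h' ⊢
  linarith

theorem sum_smul_e {n : ℕ} (x : Eucl n) : ∑ i, x i • e n i = x := by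
  simpa [e] using (EuclideanSpace.basisFun (Fin n) ℝ).sum_repr x

theorem sum_smul_c_e {n : ℕ} (x : Eucl n) : ∑ i, x i • c (e n i) = c x := by
  simpa [sum_smul_e] using (map_sum (isLinearMap_c.mk' c) (fun i => x i • e n i) .univ).symm

theorem alternating_apply_eq_sum {n : ℕ} (T : Eucl n [⋀^Fin 2]→ₗ[ℝ] ℝ) (u v : Eucl n) :
    T ![u, v] = ∑ k, ∑ l, if k < l then
      T ![e n k, e n l] * (u k * v l - u l * v k) else 0 := by
  have swap (x y : Eucl n) : T ![x, y] = -T ![y, x] := by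
    have h := T.map_swap ![y, x] (i := 0) (j := 1) (by decide)
    rw [← h]
    congr 1
    ext i : 1
    fin_cases i <;> simp
  have diag (x : Eucl n) : T ![x, x] = 0 := self_eq_neg.mp (swap x x)
  have left (w : Eucl n) : IsLinearMap ℝ fun x => T ![x, w] :=
    ⟨fun x y => T.map_vecCons_add ![w] x y, fun r x => T.map_vecCons_smul ![w] r x⟩
  have expand (x w : Eucl n) : T ![x, w] = ∑ k, x k * T ![e n k, w] := by
    conv_lhs => rw [← sum_smul_e x]
    exact (map_sum ((left w).mk' _) _ _).trans (Finset.sum_congr rfl fun k _ =>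
      (left w).map_smul _ _)
  have h : T ![u, v] = ∑ k, ∑ l, u k * v l * T ![e n k, e n l] := by
    rw [expand]
    refine Finset.sum_congr rfl fun k _ => ?_
    rw [swap, expand, ← Finset.sum_neg_distrib, Finset.mul_sum]
    refine Finset.sum_congr rfl fun l _ => ?_
    rw [swap (e n l)]
    ring
  have split (k l : Fin n) : u k * v l * T ![e n k, e n l] =
      (if k < l then u k * v l * T ![e n k, e n l] else 0) +
        if l < k then u k * v l * T ![e n k, e n l] else 0 := by
    rcases lt_trichotomy k l with hkl | rfl | hkl
    · simp [hkl, hkl.not_gt]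
    · simp [diag]
    · simp [hkl, hkl.not_gt]
  rw [h, Fintype.sum_congr _ _ fun k => Fintype.sum_congr _ _ (split k)]
  simp_rw [Finset.sum_add_distrib]
  rw [Finset.sum_comm (f := fun k l => if l < k then u k * v l * T ![e n k, e n l] else 0)]
  simp_rw [← Finset.sum_add_distrib]
  refine Finset.sum_congr rfl fun k _ => Finset.sum_congr rfl fun l _ => ?_
  split_ifs
  · rw [swap (e n l)]
    ring
  · simp

theorem stmt_2 (n : ℕ) (hn : 0 < n) (T : Eucl n [⋀^Fin 2]→ₗ[ℝ] ℝ) (u v : Eucl n)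
    (B : Module.End ℝ (ExtAlg n))
    (hB : B = ∑ k : Fin n, ∑ l : Fin n,
        if k < l then T ![e n k, e n l] • (hc (e n k) * hc (e n l)) else 0) :
    (∫ ξ : Metric.sphere (0 : Eucl n) 1,
        Tr (∑ i : Fin n, (ξ : Eucl n) i •
          (hc u * hc v * c (e n i) * B * ∑ j : Fin n, (ξ : Eucl n) j • c (e n j)))
        ∂sphMeasure n)
      = T ![u, v] * 2 ^ n * volSph n := by
  have comm (x : Eucl n) : Commute (c x) B := by
    rw [hB]
    refine Commute.sum_right _ _ _ fun k _ => Commute.sum_right _ _ _ fun l _ => ?_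
    split_ifs
    · exact (commute_c_hc_mul_hc _ _ _).smul_right _
    · exact Commute.zero_right _
  have trace_B : Tr (hc u * hc v * B) = -(T ![u, v] * 2 ^ n) := by
    rw [hB, alternating_apply_eq_sum, Finset.sum_mul, ← Finset.sum_neg_distrib, Finset.mul_sum,
      map_sum]
    refine Finset.sum_congr rfl fun k _ => ?_
    rw [Finset.sum_mul, ← Finset.sum_neg_distrib, Finset.mul_sum, map_sum]
    refine Finset.sum_congr rfl fun l _ => ?_
    split_ifs with hkl
    · rw [mul_smul_comm, map_smul, Tr_hc_mul_hc_mul_hc_mul_hc]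
      simp [e, EuclideanSpace.inner_single_right, hkl.ne']
      ring
    · simp
  have integrand (ξ : Metric.sphere (0 : Eucl n) 1) :
      Tr (∑ i : Fin n, (ξ : Eucl n) i •
        (hc u * hc v * c (e n i) * B * ∑ j : Fin n, (ξ : Eucl n) j • c (e n j))) =
        T ![u, v] * 2 ^ n := by
    have h (F : Module.End ℝ (ExtAlg n)) :
        ∑ i : Fin n, (ξ : Eucl n) i • (hc u * hc v * c (e n i) * B * F) =
          hc u * hc v * c ξ * B * F := by
      rw [← sum_smul_c_e (ξ : Eucl n), Finset.mul_sum, Finset.sum_mul, Finset.sum_mul]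
      refine Finset.sum_congr rfl fun i _ => ?_
      rw [mul_smul_comm, smul_mul_assoc, smul_mul_assoc]
    rw [sum_smul_c_e, h, mul_assoc (hc u * hc v), (comm ξ).eq, mul_assoc, mul_assoc B, c_mul_self,
      norm_eq_of_mem_sphere, mul_smul_comm, mul_smul_comm, mul_one, map_smul, trace_B]
    simp
  simp_rw [integrand]
  rw [integral_const, smul_eq_mul, mul_comm]
  rfl
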